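/- For $0\le q\le s$ (with $q>0$), every bounded convex open set $E\subset\mathbb{R}^N$ with $|E|>0$, and every nonnegative concave function $f$ on $E$, one has $\left(\frac{1}{|E|}\int_E f^s\,dx\right)^{1/s}\le \binom{N+q}{N}^{1/q}\binom{N+s}{N}^{-1/s}\left(\frac{1}{|E|}\int_E f^q\,dx\right)^{1/q}$. -/

import Mathlib

open Real MeasureTheory

open scoped ENNReal Pointwise

theorem volume_add_volume_le_of_isCompact {K L C : Set ℝ} (hK : IsCompact K) (hL : IsCompact L)
    (hK₀ : K.Nonempty) (hL₀ : L.Nonempty) (h : ∀ x ∈ K, ∀ y ∈ L, x + y ∈ C) :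
    volume K + volume L ≤ volume C := by
  obtain ⟨k, hkK, hk⟩ := hK.exists_isGreatest hK₀
  obtain ⟨l, hlL, hl⟩ := hL.exists_isLeast hL₀
  have hmeas : MeasurableSet ((fun x => x + l) '' K) :=
    (hK.image (by fun_prop)).measurableSet
  have hdisj : Disjoint ((fun x => x + l) '' K) ((fun y => k + y) '' L \ {k + l}) := by
    rw [Set.disjoint_left]
    rintro _ ⟨x, hx, rfl⟩ ⟨⟨y, hy, hxy⟩, hne⟩
    have h1 := hk hx
    have h2 := hl hy
    simp only [Set.mem_singleton_iff] at hne hxy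
    exact hne (by linarith)
  calc volume K + volume L
      = volume ((fun x => x + l) '' K) + volume ((fun y => k + y) '' L \ {k + l}) := by
        rw [measure_sdiff_null (by simp)]
        simp
    _ = volume ((fun x => x + l) '' K ∪ ((fun y => k + y) '' L \ {k + l})) :=
        (measure_union' hdisj hmeas).symm
    _ ≤ volume C := by
        refine measure_mono (Set.union_subset ?_ (Set.sdiff_subset.trans ?_))
        · rintro _ ⟨x, hx, rfl⟩
          exact h x hx l hlL
        · rintro _ ⟨y, hy, rfl⟩
          exact h k hkK y hy

/-- The one-dimensional Brunn–Minkowski inequality. -/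
theorem volume_add_volume_le {A B C : Set ℝ} (hA : MeasurableSet A) (hB : MeasurableSet B)
    (hA₀ : A.Nonempty) (hB₀ : B.Nonempty) (h : ∀ x ∈ A, ∀ y ∈ B, x + y ∈ C) :
    volume A + volume B ≤ volume C := by
  obtain ⟨x, hx⟩ := hA₀
  obtain ⟨y, hy⟩ := hB₀
  rw [hA.measure_eq_iSup_isCompact, hB.measure_eq_iSup_isCompact]
  simp only [iSup_and']
  refine ENNReal.biSup_add_biSup_le' (p := fun K => K ⊆ A ∧ IsCompact K)
    (q := fun L => L ⊆ B ∧ IsCompact L) ⟨∅, A.empty_subset, isCompact_empty⟩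
    ⟨∅, B.empty_subset, isCompact_empty⟩ fun K hK L hL => ?_
  refine (add_le_add (measure_mono (Set.subset_insert x K))
    (measure_mono (Set.subset_insert y L))).trans ?_
  exact volume_add_volume_le_of_isCompact (hK.2.insert x) (hL.2.insert y)
    (Set.insert_nonempty _ _) (Set.insert_nonempty _ _) fun u hu v hv =>
      h u (Set.insert_subset hx hK.1 hu) v (Set.insert_subset hy hL.1 hv)

theorem smul_volume_add_le {A B C : Set ℝ} {a b : ℝ} (ha : 0 < a) (hb : 0 < b)
    (hA : MeasurableSet A) (hB : MeasurableSet B)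
    (hA₀ : A.Nonempty) (hB₀ : B.Nonempty) (h : ∀ x ∈ A, ∀ y ∈ B, a * x + b * y ∈ C) :
    ENNReal.ofReal a * volume A + ENNReal.ofReal b * volume B ≤ volume C := by
  have := volume_add_volume_le (C := C) (hA.const_smul₀ a) (hB.const_smul₀ b) (hA₀.smul_set)
    (hB₀.smul_set) (by
      rintro _ ⟨x, hx, rfl⟩ _ ⟨y, hy, rfl⟩
      exact h x hx y hy)
  simpa [Measure.addHaar_smul, abs_of_pos ha, abs_of_pos hb] using this

theorem lintegral_eq_lintegral_volume_lt {F : ℝ → ℝ≥0∞} (hF : Measurable F) (hF1 : ∀ x, F x ≤ 1) :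
    ∫⁻ x, F x = ∫⁻ t in Set.Ioi (0 : ℝ), volume {x | ENNReal.ofReal t < F x} := by
  have hfin : ∀ x, F x ≠ ∞ := fun x => ne_top_of_le_ne_top ENNReal.one_ne_top (hF1 x)
  have := lintegral_eq_lintegral_meas_lt volume (f := fun x => (F x).toReal)
    (Filter.Eventually.of_forall fun x => ENNReal.toReal_nonneg) hF.ennreal_toReal.aemeasurable
  simp only [ENNReal.ofReal_toReal (hfin _)] at this
  rw [this]
  refine setLIntegral_congr_fun measurableSet_Ioi fun t ht => ?_
  simp only [ENNReal.ofReal_lt_iff_lt_toReal (le_of_lt ht) (hfin _)]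

theorem ENNReal.rpow_mul_rpow_le_add {a b : ℝ} (ha : 0 < a) (hb : 0 < b) (hab : a + b = 1)
    (x y : ℝ≥0∞) : x ^ a * y ^ b ≤ ENNReal.ofReal a * x + ENNReal.ofReal b * y := by
  have hpq : (a⁻¹).HolderConjugate b⁻¹ := by
    rw [Real.holderConjugate_iff]
    refine ⟨(one_lt_inv₀ ha).2 (by linarith), by simpa using hab⟩
  have := ENNReal.young_inequality (x ^ a) (y ^ b) hpq
  rw [← ENNReal.rpow_mul, ← ENNReal.rpow_mul, mul_inv_cancel₀ ha.ne', mul_inv_cancel₀ hb.ne',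
    ENNReal.rpow_one, ENNReal.rpow_one, ENNReal.ofReal_inv_of_pos ha,
    ENNReal.ofReal_inv_of_pos hb, div_eq_mul_inv, div_eq_mul_inv, inv_inv, inv_inv] at this
  simpa [mul_comm] using this

theorem ENNReal.lt_rpow_mul_rpow {a b : ℝ} (ha : 0 < a) (hb : 0 < b) (hab : a + b = 1)
    {t x y : ℝ≥0∞} (hx : t < x) (hy : t < y) : t < x ^ a * y ^ b := by
  rcases eq_or_ne t 0 with rfl | ht
  · have h1 : x ^ a ≠ 0 := by simp [hx.ne', ha.not_gt]
    have h2 : y ^ b ≠ 0 := by simp [hy.ne', hb.not_gt]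
    exact pos_iff_ne_zero.2 (mul_ne_zero h1 h2)
  · calc t = t ^ a * t ^ b := by
          rw [← ENNReal.rpow_add _ _ ht hx.ne_top, hab, ENNReal.rpow_one]
      _ < x ^ a * y ^ b := ENNReal.mul_lt_mul (ENNReal.rpow_lt_rpow hx ha)
          (ENNReal.rpow_lt_rpow hy hb)

/-- The one-dimensional Prékopa–Leindler inequality for functions with supremum one. -/
theorem prekopa_leindler_real_of_iSup_eq_one {a b : ℝ} (ha : 0 < a) (hb : 0 < b) (hab : a + b = 1)
    {F G H : ℝ → ℝ≥0∞} (hF : Measurable F) (hG : Measurable G) (hH : Measurable H)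
    (hF1 : ⨆ x, F x = 1) (hG1 : ⨆ x, G x = 1)
    (h : ∀ x y, F x ^ a * G y ^ b ≤ H (a * x + b * y)) :
    (∫⁻ x, F x) ^ a * (∫⁻ x, G x) ^ b ≤ ∫⁻ x, H x := by
  have hFle : ∀ x, F x ≤ 1 := fun x => hF1 ▸ le_iSup F x
  have hGle : ∀ x, G x ≤ 1 := fun x => hG1 ▸ le_iSup G x
  refine (ENNReal.rpow_mul_rpow_le_add ha hb hab _ _).trans ?_
  refine le_trans ?_ (lintegral_mono (fun x => min_le_left (H x) 1))
  rw [lintegral_eq_lintegral_volume_lt hF hFle, lintegral_eq_lintegral_volume_lt hG hGle,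
    lintegral_eq_lintegral_volume_lt (hH.min measurable_const) (fun x => min_le_right _ _),
    ← lintegral_const_mul' _ _ ENNReal.ofReal_ne_top,
    ← lintegral_const_mul' _ _ ENNReal.ofReal_ne_top, ← lintegral_add_left]
  · refine setLIntegral_mono' measurableSet_Ioi fun t ht => ?_
    rcases lt_or_ge t 1 with ht1 | ht1
    · have ht1' : ENNReal.ofReal t < 1 := by simpa using ht1
      obtain ⟨x₀, hx₀⟩ := lt_iSup_iff.1 (hF1 ▸ ht1' : ENNReal.ofReal t < ⨆ x, F x)
      obtain ⟨y₀, hy₀⟩ := lt_iSup_iff.1 (hG1 ▸ ht1' : ENNReal.ofReal t < ⨆ x, G x)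
      refine smul_volume_add_le ha hb (measurableSet_lt measurable_const hF)
        (measurableSet_lt measurable_const hG) ⟨x₀, hx₀⟩ ⟨y₀, hy₀⟩ fun x hx y hy => ?_
      exact lt_min ((ENNReal.lt_rpow_mul_rpow ha hb hab hx hy).trans_le (h x y)) ht1'
    · have h1 : ∀ z : ℝ≥0∞, z ≤ 1 → ¬ ENNReal.ofReal t < z := fun z hz =>
        (hz.trans (by simpa using ht1)).not_gt
      simp [h1 _ (hFle _), h1 _ (hGle _)]
  · refine Measurable.const_mul ?_ _
    refine Antitone.measurable fun s t hst => measure_mono fun x hx => ?_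
    exact (ENNReal.ofReal_le_ofReal hst).trans_lt hx

theorem prekopa_leindler_real_of_iSup_ne_top {a b : ℝ} (ha : 0 < a) (hb : 0 < b) (hab : a + b = 1)
    {F G H : ℝ → ℝ≥0∞} (hF : Measurable F) (hG : Measurable G) (hH : Measurable H)
    (hF1 : ⨆ x, F x ≠ ∞) (hG1 : ⨆ x, G x ≠ ∞)
    (h : ∀ x y, F x ^ a * G y ^ b ≤ H (a * x + b * y)) :
    (∫⁻ x, F x) ^ a * (∫⁻ x, G x) ^ b ≤ ∫⁻ x, H x := by
  set S := ⨆ x, F x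
  set T := ⨆ x, G x
  rcases eq_or_ne S 0 with hS0 | hS0
  · have : F = 0 := by
      ext x
      exact ENNReal.iSup_eq_zero.1 hS0 x
    simp [this, ha]
  rcases eq_or_ne T 0 with hT0 | hT0
  · have : G = 0 := by
      ext x
      exact ENNReal.iSup_eq_zero.1 hT0 x
    simp [this, hb]
  have hc0 : S ^ a * T ^ b ≠ 0 := by simp [hS0, hT0, hF1, hG1]
  have hct : S ^ a * T ^ b ≠ ∞ := ENNReal.mul_ne_top
    (ENNReal.rpow_ne_top_of_nonneg ha.le hF1) (ENNReal.rpow_ne_top_of_nonneg hb.le hG1)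
  have hinv : (S⁻¹) ^ a * (T⁻¹) ^ b = (S ^ a * T ^ b)⁻¹ := by
    rw [ENNReal.mul_inv (Or.inr (ENNReal.rpow_ne_top_of_nonneg hb.le hG1))
      (Or.inl (ENNReal.rpow_ne_top_of_nonneg ha.le hF1)), ENNReal.inv_rpow, ENNReal.inv_rpow]
  have key := prekopa_leindler_real_of_iSup_eq_one ha hb hab (hF.const_mul S⁻¹)
    (hG.const_mul T⁻¹) (hH.const_mul (S ^ a * T ^ b)⁻¹)
    (by rw [← ENNReal.mul_iSup, ENNReal.inv_mul_cancel hS0 hF1])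
    (by rw [← ENNReal.mul_iSup, ENNReal.inv_mul_cancel hT0 hG1])
    (fun x y => by
      rw [ENNReal.mul_rpow_of_nonneg _ _ ha.le, ENNReal.mul_rpow_of_nonneg _ _ hb.le,
        mul_mul_mul_comm, hinv]
      gcongr
      exact h x y)
  rw [lintegral_const_mul _ hF, lintegral_const_mul _ hG, lintegral_const_mul _ hH,
    ENNReal.mul_rpow_of_nonneg _ _ ha.le, ENNReal.mul_rpow_of_nonneg _ _ hb.le,
    mul_mul_mul_comm, hinv] at key
  exact (ENNReal.mul_le_mul_iff_right (ENNReal.inv_ne_zero.2 hct) (ENNReal.inv_ne_top.2 hc0)).1 key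

theorem tendsto_lintegral_min_natCast {α : Type*} [MeasurableSpace α] (μ : Measure α)
    {F : α → ℝ≥0∞} (hF : Measurable F) :
    Filter.Tendsto (fun n : ℕ => ∫⁻ x, min (F x) n ∂μ) Filter.atTop (nhds (∫⁻ x, F x ∂μ)) := by
  refine lintegral_tendsto_of_tendsto_of_monotone
    (fun n => (hF.min measurable_const).aemeasurable) ?_ ?_
  · exact Filter.Eventually.of_forall fun x m n hmn => min_le_min_left _ (by exact_mod_cast hmn)
  · refine Filter.Eventually.of_forall fun x => ?_
    simpa using tendsto_const_nhds.min ENNReal.tendsto_nat_nhds_top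

/-- The one-dimensional Prékopa–Leindler inequality. -/
theorem prekopa_leindler_real {a b : ℝ} (ha : 0 < a) (hb : 0 < b) (hab : a + b = 1)
    {F G H : ℝ → ℝ≥0∞} (hF : Measurable F) (hG : Measurable G) (hH : Measurable H)
    (h : ∀ x y, F x ^ a * G y ^ b ≤ H (a * x + b * y)) :
    (∫⁻ x, F x) ^ a * (∫⁻ x, G x) ^ b ≤ ∫⁻ x, H x := by
  rcases eq_or_ne (∫⁻ x, F x) 0 with hF0 | hF0
  · simp [hF0, ha]
  rcases eq_or_ne (∫⁻ x, G x) 0 with hG0 | hG0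
  · simp [hG0, hb]
  have hlim := ENNReal.Tendsto.mul
    ((ENNReal.continuous_rpow_const (y := a)).continuousAt.tendsto.comp
      (tendsto_lintegral_min_natCast volume hF)) (Or.inl (by simp [hF0, ha, ha.not_gt]))
    ((ENNReal.continuous_rpow_const (y := b)).continuousAt.tendsto.comp
      (tendsto_lintegral_min_natCast volume hG)) (Or.inl (by simp [hG0, hb, hb.not_gt]))
  refine le_of_tendsto' hlim fun n => ?_
  refine prekopa_leindler_real_of_iSup_ne_top ha hb hab (hF.min measurable_const)
    (hG.min measurable_const) hH ?_ ?_ fun x y => le_trans ?_ (h x y)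
  · exact ne_top_of_le_ne_top (ENNReal.natCast_ne_top n) (iSup_le fun x => min_le_right _ _)
  · exact ne_top_of_le_ne_top (ENNReal.natCast_ne_top n) (iSup_le fun x => min_le_right _ _)
  · gcongr
    · exact min_le_left _ _
    · exact min_le_left _ _

/-- The **Prékopa–Leindler inequality**. -/
theorem prekopa_leindler {a b : ℝ} (ha : 0 < a) (hb : 0 < b) (hab : a + b = 1) {n : ℕ}
    {F G H : (Fin n → ℝ) → ℝ≥0∞} (hF : Measurable F) (hG : Measurable G) (hH : Measurable H)
    (h : ∀ x y, F x ^ a * G y ^ b ≤ H (a • x + b • y)) :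
    (∫⁻ x, F x) ^ a * (∫⁻ x, G x) ^ b ≤ ∫⁻ x, H x := by
  induction n with
  | zero =>
    have h0 := h default default
    rw [Subsingleton.elim (a • (default : Fin 0 → ℝ) + b • default) default] at h0
    simp only [lintegral_unique, Measure.volume_pi_eq_dirac 0, measure_univ, mul_one]
    convert h0
  | succ n ih =>
    set e := (MeasurableEquiv.piFinSuccAbove (fun _ : Fin (n + 1) => ℝ) 0).symm with he
    have hmp := (volume_preserving_piFinSuccAbove (fun _ : Fin (n + 1) => ℝ) 0).symm
    have hfub : ∀ {K : (Fin (n + 1) → ℝ) → ℝ≥0∞}, Measurable K →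
        ∫⁻ x, K x = ∫⁻ r : ℝ, ∫⁻ v : Fin n → ℝ, K (e (r, v)) := fun {K} hK => by
      rw [← hmp.lintegral_comp hK, Measure.volume_eq_prod, lintegral_prod]
      exact (hK.comp e.measurable).aemeasurable
    have hmeas : ∀ {K : (Fin (n + 1) → ℝ) → ℝ≥0∞}, Measurable K →
        Measurable fun r : ℝ => ∫⁻ v : Fin n → ℝ, K (e (r, v)) := fun {K} hK =>
      (hK.comp e.measurable).lintegral_prod_right'
    rw [hfub hF, hfub hG, hfub hH]
    refine prekopa_leindler_real ha hb hab (hmeas hF) (hmeas hG) (hmeas hH) fun r s => ?_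
    refine ih (hF.comp (e.measurable.comp measurable_prodMk_left))
      (hG.comp (e.measurable.comp measurable_prodMk_left))
      (hH.comp (e.measurable.comp measurable_prodMk_left)) fun v w => ?_
    refine (h (e (r, v)) (e (s, w))).trans_eq ?_
    congr 1
    ext i
    refine Fin.cases ?_ (fun j => ?_) i <;> simp [he, MeasurableEquiv.piFinSuccAbove]

theorem EuclideanSpace.volume_eq_lintegral_indicator {n : ℕ} {A : Set (EuclideanSpace ℝ (Fin n))}
    (hA : MeasurableSet A) :
    volume A = ∫⁻ v : Fin n → ℝ, A.indicator 1 (WithLp.toLp 2 v) := by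
  rw [(PiLp.volume_preserving_toLp (Fin n)).lintegral_comp (measurable_one.indicator hA),
    lintegral_indicator_one hA]

/-- The multiplicative Brunn–Minkowski inequality. -/
theorem EuclideanSpace.volume_rpow_mul_volume_rpow_le {n : ℕ} {a b : ℝ} (ha : 0 < a) (hb : 0 < b)
    (hab : a + b = 1) {A B C : Set (EuclideanSpace ℝ (Fin n))} (hA : MeasurableSet A)
    (hB : MeasurableSet B) (hC : MeasurableSet C)
    (h : ∀ x ∈ A, ∀ y ∈ B, a • x + b • y ∈ C) :
    volume A ^ a * volume B ^ b ≤ volume C := by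
  have hmeas := (PiLp.volume_preserving_toLp (Fin n)).measurable
  rw [volume_eq_lintegral_indicator hA, volume_eq_lintegral_indicator hB,
    volume_eq_lintegral_indicator hC]
  refine prekopa_leindler ha hb hab ((measurable_one.indicator hA).comp hmeas)
    ((measurable_one.indicator hB).comp hmeas) ((measurable_one.indicator hC).comp hmeas)
    fun x y => ?_
  by_cases hx : WithLp.toLp 2 x ∈ A
  · by_cases hy : WithLp.toLp 2 y ∈ B
    · simp [hx, hy, h _ hx _ hy]
    · simp [hy, hb]
  · simp [hx, ha]

theorem EuclideanSpace.le_volume_inv_smul_iff {n : ℕ} {c : ℝ} (hc : 0 < c) {V : ℝ≥0∞}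
    {A : Set (EuclideanSpace ℝ (Fin n))} :
    V ≤ volume (c⁻¹ • A) ↔ V * ENNReal.ofReal c ^ n ≤ volume A := by
  rw [Measure.addHaar_smul, finrank_euclideanSpace_fin, abs_of_pos (by positivity),
    inv_pow, ENNReal.ofReal_inv_of_pos (by positivity), ENNReal.ofReal_pow hc.le, mul_comm,
    ← div_eq_mul_inv, ENNReal.le_div_iff_mul_le (by simp [hc]) (by simp)]

/-- The Brunn–Minkowski inequality, with the volumes compared to a common value `V`. -/
theorem EuclideanSpace.brunn_minkowski {n : ℕ} {a b r t : ℝ} (ha : 0 < a) (hb : 0 < b)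
    (hr : 0 < r) (ht : 0 < t) {A B C : Set (EuclideanSpace ℝ (Fin n))} (hA : MeasurableSet A)
    (hB : MeasurableSet B) (hC : MeasurableSet C)
    (h : ∀ x ∈ A, ∀ y ∈ B, a • x + b • y ∈ C) {V : ℝ≥0∞}
    (hVA : V * ENNReal.ofReal r ^ n ≤ volume A) (hVB : V * ENNReal.ofReal t ^ n ≤ volume B) :
    V * ENNReal.ofReal (a * r + b * t) ^ n ≤ volume C := by
  set σ := a * r + b * t
  have hσ₀ : 0 < σ := by positivity
  rw [← le_volume_inv_smul_iff hr] at hVA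
  rw [← le_volume_inv_smul_iff ht] at hVB
  rw [← le_volume_inv_smul_iff hσ₀]
  have hsum : a * r / σ + b * t / σ = 1 := by rw [← add_div, div_self hσ₀.ne']
  calc V = V ^ (a * r / σ) * V ^ (b * t / σ) := by
        rw [← ENNReal.rpow_add_of_nonneg _ _ (by positivity) (by positivity), hsum,
          ENNReal.rpow_one]
    _ ≤ volume (r⁻¹ • A) ^ (a * r / σ) * volume (t⁻¹ • B) ^ (b * t / σ) := by gcongr
    _ ≤ volume (σ⁻¹ • C) := by
        refine volume_rpow_mul_volume_rpow_le (by positivity) (by positivity) hsum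
          (hA.const_smul₀ _) (hB.const_smul₀ _) (hC.const_smul₀ _) ?_
        rintro _ ⟨x, hx, rfl⟩ _ ⟨y, hy, rfl⟩
        refine ⟨a • x + b • y, h x hx y hy, ?_⟩
        simp only [smul_add, smul_smul]
        congr 2 <;> field_simp

theorem ConcaveOn.measurableSet_lt {n : ℕ} {E : Set (EuclideanSpace ℝ (Fin n))}
    {f : EuclideanSpace ℝ (Fin n) → ℝ} (hf : ConcaveOn ℝ E f) (hE : IsOpen E) (t : ℝ) :
    MeasurableSet ({x | t < f x} ∩ E) := by
  rw [Set.inter_comm]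
  exact ((hf.continuousOn hE).isOpen_inter_preimage hE isOpen_Ioi).measurableSet

theorem ConcaveOn.measure_lt_ge_of_measure_lt_gt {n : ℕ} {E : Set (EuclideanSpace ℝ (Fin n))}
    {f : EuclideanSpace ℝ (Fin n) → ℝ} (hE : IsOpen E) (hf : ConcaveOn ℝ E f)
    (hf0 : ∀ x ∈ E, 0 ≤ f x) {t u : ℝ} (ht : 0 < t) (htu : t < u)
    (hu : (Set.Iio 1).indicator (fun v => volume E * ENNReal.ofReal (1 - v) ^ n) u <
      volume ({x | u < f x} ∩ E)) :
    (Set.Iio 1).indicator (fun v => volume E * ENNReal.ofReal (1 - v) ^ n) t ≤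
      volume ({x | t < f x} ∩ E) := by
  rcases le_or_gt 1 t with ht1 | ht1
  · simp [ht1]
  have hu0 : 0 < u := ht.trans htu
  have hr0 : 0 < t / u := by positivity
  have hr1 : 0 < 1 - t / u := by rw [sub_pos, div_lt_one hu0]; exact htu
  have hcomb : ∀ x ∈ E, ∀ y ∈ {x | u < f x} ∩ E,
      (1 - t / u) • x + (t / u) • y ∈ {x | t < f x} ∩ E := by
    rintro x hx y ⟨hy, hyE⟩
    refine ⟨lt_of_lt_of_le ?_ (hf.2 hx hyE hr1.le hr0.le (by ring)),
      hf.1 hx hyE hr1.le hr0.le (by ring)⟩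
    have h1 : t / u * u < t / u * f y := mul_lt_mul_of_pos_left hy hr0
    have h2 := mul_nonneg hr1.le (hf0 x hx)
    rw [div_mul_cancel₀ _ hu0.ne'] at h1
    simp only [smul_eq_mul]
    linarith
  rw [Set.indicator_of_mem (by exact ht1)]
  rcases lt_or_ge u 1 with hu1 | hu1
  · rw [Set.indicator_of_mem (by exact hu1)] at hu
    have := EuclideanSpace.brunn_minkowski hr1 hr0 one_pos (sub_pos.2 hu1) hE.measurableSet
      (hf.measurableSet_lt hE u) (hf.measurableSet_lt hE t) hcomb (V := volume E) (by simp) hu.le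
    convert this using 4
    field_simp
    ring
  · obtain ⟨y, hy⟩ := nonempty_of_measure_ne_zero (bot_lt_of_lt hu).ne'
    calc volume E * ENNReal.ofReal (1 - t) ^ n
        ≤ volume E * ENNReal.ofReal (1 - t / u) ^ n := by
          gcongr
          exact div_le_self ht.le hu1
      _ = volume ((fun x => x + (t / u) • y) '' ((1 - t / u) • E)) := by
          rw [Set.image_add_right, measure_preimage_add_right, Measure.addHaar_smul,
            finrank_euclideanSpace_fin, abs_of_pos (by positivity), ENNReal.ofReal_pow hr1.le,
            mul_comm]
      _ ≤ _ := by
          refine measure_mono ?_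
          rintro _ ⟨_, ⟨x, hx, rfl⟩, rfl⟩
          exact hcomb x hx y hy

theorem ENNReal.mul_add_mul_le_mul_add_mul_of_le {a b c d : ℝ≥0∞} (hab : a ≤ b) (hcd : c ≤ d) :
    a * d + b * c ≤ a * c + b * d := by
  obtain ⟨b, rfl⟩ := exists_add_of_le hab
  obtain ⟨d, rfl⟩ := exists_add_of_le hcd
  calc a * (c + d) + (a + b) * c ≤ a * (c + d) + (a + b) * c + b * d := le_self_add
    _ = a * c + (a + b) * (c + d) := by ring

theorem lintegral_mul_rpow_le_of_crossing {m ν : ℝ → ℝ≥0∞} (hm : Measurable m)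
    (hν : Measurable ν) {q s t₀ : ℝ} (hqs : q ≤ s) (ht₀ : 0 ≤ t₀)
    (hlt : ∀ t, 0 < t → t < t₀ → ν t ≤ m t) (hgt : ∀ t, t₀ < t → m t ≤ ν t)
    (heq : ∫⁻ t in Set.Ioi 0, m t * ENNReal.ofReal (t ^ (q - 1)) =
      ∫⁻ t in Set.Ioi 0, ν t * ENNReal.ofReal (t ^ (q - 1)))
    (hfin : ∫⁻ t in Set.Ioi 0, ν t * ENNReal.ofReal (t ^ (q - 1)) ≠ ∞) :
    ∫⁻ t in Set.Ioi 0, m t * ENNReal.ofReal (t ^ (s - 1)) ≤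
      ∫⁻ t in Set.Ioi 0, ν t * ENNReal.ofReal (t ^ (s - 1)) := by
  set k := ENNReal.ofReal (t₀ ^ (s - q))
  have key : ∫⁻ t in Set.Ioi 0, (m t * ENNReal.ofReal (t ^ (s - 1)) +
        k * (ν t * ENNReal.ofReal (t ^ (q - 1)))) ≤
      ∫⁻ t in Set.Ioi 0, (ν t * ENNReal.ofReal (t ^ (s - 1)) +
        k * (m t * ENNReal.ofReal (t ^ (q - 1)))) := by
    refine setLIntegral_mono' measurableSet_Ioi fun t ht => ?_
    have ht' : (0 : ℝ) < t := ht
    have hsplit : ENNReal.ofReal (t ^ (s - 1)) =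
        ENNReal.ofReal (t ^ (s - q)) * ENNReal.ofReal (t ^ (q - 1)) := by
      rw [← ENNReal.ofReal_mul (by positivity), ← Real.rpow_add ht']
      ring_nf
    have hcross : ENNReal.ofReal (t ^ (s - q)) * m t + k * ν t ≤
        ENNReal.ofReal (t ^ (s - q)) * ν t + k * m t := by
      rcases lt_trichotomy t t₀ with h | rfl | h
      · exact ENNReal.mul_add_mul_le_mul_add_mul_of_le (ENNReal.ofReal_le_ofReal
          (Real.rpow_le_rpow ht'.le h.le (by linarith))) (hlt t ht' h)
      · rw [add_comm]
      · simpa only [add_comm] using ENNReal.mul_add_mul_le_mul_add_mul_of_le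
          (ENNReal.ofReal_le_ofReal (Real.rpow_le_rpow ht₀ h.le (by linarith))) (hgt t h)
    rw [hsplit]
    calc _ = (ENNReal.ofReal (t ^ (s - q)) * m t + k * ν t) * ENNReal.ofReal (t ^ (q - 1)) := by
          ring
      _ ≤ (ENNReal.ofReal (t ^ (s - q)) * ν t + k * m t) * ENNReal.ofReal (t ^ (q - 1)) := by
          gcongr
      _ = _ := by ring
  rw [lintegral_add_left (by fun_prop), lintegral_add_left (by fun_prop),
    lintegral_const_mul _ (by fun_prop), lintegral_const_mul _ (by fun_prop), heq] at key
  exact (ENNReal.add_le_add_iff_right (ENNReal.mul_ne_top ENNReal.ofReal_ne_top hfin)).1 key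

theorem lintegral_one_sub_pow_mul_rpow (n : ℕ) {p : ℝ} (hp : 0 < p) (V : ℝ≥0∞) :
    ENNReal.ofReal p * ∫⁻ t in Set.Ioi 0,
      (Set.Iio 1).indicator (fun v => V * ENNReal.ofReal (1 - v) ^ n) t *
        ENNReal.ofReal (t ^ (p - 1)) =
      V * ENNReal.ofReal ((Gamma (n + p + 1) / (Gamma (p + 1) * Gamma (n + 1)))⁻¹) := by
  have hbeta := ProbabilityTheory.beta_pos hp (β := n + 1) (by positivity)
  have h1 := ProbabilityTheory.lintegral_betaPDF_eq_one hp (β := n + 1) (by positivity)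
  rw [ProbabilityTheory.lintegral_betaPDF] at h1
  have h2 : ∫⁻ t in Set.Ioi 0,
      (Set.Iio 1).indicator (fun v => V * ENNReal.ofReal (1 - v) ^ n) t *
        ENNReal.ofReal (t ^ (p - 1)) = V * ENNReal.ofReal (ProbabilityTheory.beta p (n + 1)) := by
    rw [← mul_one (V * _), ← h1, ← lintegral_const_mul _ (by fun_prop),
      ← lintegral_indicator measurableSet_Ioi, ← lintegral_indicator measurableSet_Ioo]
    refine lintegral_congr fun t => ?_
    by_cases ht0 : 0 < t
    · by_cases ht1 : t < 1
      · have h3 : 0 < 1 - t := by linarith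
        rw [Set.indicator_of_mem (by exact ht0), Set.indicator_of_mem (by exact ht1),
          Set.indicator_of_mem (by exact ⟨ht0, ht1⟩), mul_assoc, mul_assoc,
          ← ENNReal.ofReal_pow h3.le, ← ENNReal.ofReal_mul (by positivity),
          ← ENNReal.ofReal_mul hbeta.le]
        congr 2
        rw [add_sub_cancel_right, Real.rpow_natCast]
        field_simp
      · simp [ht1]
    · simp [ht0]
  rw [h2, mul_left_comm, ← ENNReal.ofReal_mul hp.le, ProbabilityTheory.beta, Gamma_add_one hp.ne']
  congr 2
  rw [inv_div, show p + (n + 1 : ℝ) = n + p + 1 by ring]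
  ring

theorem ConcaveOn.bddAbove_image {n : ℕ} {E : Set (EuclideanSpace ℝ (Fin n))}
    {f : EuclideanSpace ℝ (Fin n) → ℝ} (hE : IsOpen E) (hbdd : Bornology.IsBounded E)
    (hf : ConcaveOn ℝ E f) (hf0 : ∀ x ∈ E, 0 ≤ f x) : BddAbove (f '' E) := by
  rcases E.eq_empty_or_nonempty with rfl | ⟨x₀, hx₀⟩
  · simp
  obtain ⟨r, hr, hball⟩ := Metric.isOpen_iff.1 hE x₀ hx₀
  obtain ⟨D, hD⟩ := hbdd.subset_ball x₀
  have hD0 : 0 < D := by simpa using hD hx₀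
  have hε : 0 < r / D := by positivity
  refine ⟨(1 + r / D) / (r / D) * f x₀, ?_⟩
  rintro _ ⟨x, hx, rfl⟩
  have hy : x₀ - (r / D) • (x - x₀) ∈ E := by
    refine hball ?_
    have h1 : ‖x - x₀‖ < D := by simpa [dist_eq_norm] using hD hx
    rw [Metric.mem_ball, dist_eq_norm, sub_sub_cancel_left, norm_neg, norm_smul,
      Real.norm_of_nonneg hε.le]
    calc r / D * ‖x - x₀‖ < r / D * D := by gcongr
      _ = r := by field_simp
  have hc := hf.2 hy hx (show 0 ≤ 1 / (1 + r / D) by positivity)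
    (show 0 ≤ r / D / (1 + r / D) by positivity) (by field_simp)
  have hx₀' : (1 / (1 + r / D)) • (x₀ - (r / D) • (x - x₀)) + (r / D / (1 + r / D)) • x = x₀ := by
    match_scalars <;> field_simp <;> ring
  rw [hx₀'] at hc
  have h2 : 0 ≤ 1 / (1 + r / D) * f (x₀ - (r / D) • (x - x₀)) :=
    mul_nonneg (by positivity) (hf0 _ hy)
  simp only [smul_eq_mul] at hc
  rw [div_mul_eq_mul_div, le_div_iff₀ hε]
  have h3 : r / D / (1 + r / D) * f x ≤ f x₀ := by linarith
  rw [div_mul_eq_mul_div, div_le_iff₀ (by positivity)] at h3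
  linarith

theorem ConcaveOn.lintegral_rpow_le_of_lintegral_rpow_eq {n : ℕ}
    {E : Set (EuclideanSpace ℝ (Fin n))} {f : EuclideanSpace ℝ (Fin n) → ℝ} (hE : IsOpen E)
    (hbdd : Bornology.IsBounded E) (hf : ConcaveOn ℝ E f) (hf0 : ∀ x ∈ E, 0 ≤ f x) {q s : ℝ}
    (hq : 0 < q) (hqs : q ≤ s)
    (h : ∫⁻ x in E, ENNReal.ofReal (f x ^ q) =
      volume E * ENNReal.ofReal ((Gamma (n + q + 1) / (Gamma (q + 1) * Gamma (n + 1)))⁻¹)) :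
    ∫⁻ x in E, ENNReal.ofReal (f x ^ s) ≤
      volume E * ENNReal.ofReal ((Gamma (n + s + 1) / (Gamma (s + 1) * Gamma (n + 1)))⁻¹) := by
  have hs : 0 < s := hq.trans_le hqs
  have hnn : 0 ≤ᵐ[volume.restrict E] f :=
    (ae_restrict_iff' hE.measurableSet).2 (Filter.Eventually.of_forall hf0)
  have hmeas : AEMeasurable f (volume.restrict E) :=
    (hf.continuousOn hE).aemeasurable hE.measurableSet
  have hr : ∀ t, (volume.restrict E) {x | t < f x} = volume ({x | t < f x} ∩ E) := fun t =>
    Measure.restrict_apply' hE.measurableSet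
  have hcoef := lintegral_one_sub_pow_mul_rpow n hq (volume E)
  rw [lintegral_rpow_eq_lintegral_meas_lt_mul _ hnn hmeas hq, ← hcoef] at h
  rw [lintegral_rpow_eq_lintegral_meas_lt_mul _ hnn hmeas hs,
    ← lintegral_one_sub_pow_mul_rpow n hs]
  simp only [hr] at h ⊢
  have hq' : ENNReal.ofReal q ≠ 0 := by simpa using hq
  rw [ENNReal.mul_right_inj hq' ENNReal.ofReal_ne_top] at h
  gcongr ENNReal.ofReal s * ?_
  set ν : ℝ → ℝ≥0∞ := (Set.Iio 1).indicator fun v => volume E * ENNReal.ofReal (1 - v) ^ n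
  set S := {t : ℝ | 0 < t ∧ ν t < volume ({x | t < f x} ∩ E)}
  have hS_bdd : BddAbove S := by
    obtain ⟨M, hM⟩ := hf.bddAbove_image hE hbdd hf0
    refine ⟨M, fun t ht => ?_⟩
    obtain ⟨x, hxt, hxE⟩ := nonempty_of_measure_ne_zero (bot_lt_of_lt ht.2).ne'
    exact (le_of_lt hxt).trans (hM ⟨x, hxE, rfl⟩)
  refine lintegral_mul_rpow_le_of_crossing ?_ ?_ hqs (t₀ := sSup S)
    (Real.sSup_nonneg fun t ht => ht.1.le) ?_ ?_ h ?_
  · refine Antitone.measurable fun t u htu => measure_mono ?_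
    exact Set.inter_subset_inter_left _ fun x hx => htu.trans_lt hx
  · exact Measurable.indicator (by fun_prop) measurableSet_Iio
  · intro t ht htS
    have hne : S.Nonempty := by
      by_contra hemp
      rw [Set.not_nonempty_iff_eq_empty.1 hemp, Real.sSup_empty] at htS
      exact ht.not_gt htS
    obtain ⟨u, hu, htu⟩ := exists_lt_of_lt_csSup hne htS
    exact hf.measure_lt_ge_of_measure_lt_gt hE hf0 ht htu hu.2
  · intro t htS
    by_contra! hlt
    have ht : 0 < t := (Real.sSup_nonneg fun t ht => ht.1.le : 0 ≤ sSup S).trans_lt htS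
    exact htS.not_ge (le_csSup hS_bdd ⟨ht, hlt⟩)
  · intro htop
    rw [htop, ENNReal.mul_top hq'] at hcoef
    exact ENNReal.mul_ne_top hbdd.measure_lt_top.ne ENNReal.ofReal_ne_top hcoef.symm

theorem ConcaveOn.integrableOn_rpow {n : ℕ} {E : Set (EuclideanSpace ℝ (Fin n))}
    {f : EuclideanSpace ℝ (Fin n) → ℝ} (hE : IsOpen E) (hbdd : Bornology.IsBounded E)
    (hf : ConcaveOn ℝ E f) (hf0 : ∀ x ∈ E, 0 ≤ f x) {p : ℝ} (hp : 0 ≤ p) :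
    IntegrableOn (fun x => f x ^ p) E := by
  obtain ⟨M, hM⟩ := hf.bddAbove_image hE hbdd hf0
  have := isFiniteMeasure_restrict.2 (hbdd.measure_lt_top (μ := volume)).ne
  refine Integrable.of_bound (((hf.continuousOn hE).rpow_const fun x _ =>
    Or.inr hp).aestronglyMeasurable hE.measurableSet) (M ^ p) ?_
  refine (ae_restrict_iff' hE.measurableSet).2 (Filter.Eventually.of_forall fun x hx => ?_)
  rw [Real.norm_of_nonneg (Real.rpow_nonneg (hf0 x hx) p)]
  exact Real.rpow_le_rpow (hf0 x hx) (hM ⟨x, hx, rfl⟩) hp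

theorem ConcaveOn.integral_rpow_le_of_integral_rpow_eq {n : ℕ}
    {E : Set (EuclideanSpace ℝ (Fin n))} {f : EuclideanSpace ℝ (Fin n) → ℝ} (hE : IsOpen E)
    (hbdd : Bornology.IsBounded E) (hf : ConcaveOn ℝ E f) (hf0 : ∀ x ∈ E, 0 ≤ f x) {q s : ℝ}
    (hq : 0 < q) (hqs : q ≤ s)
    (h : ∫ x in E, f x ^ q =
      (volume E).toReal * (Gamma (n + q + 1) / (Gamma (q + 1) * Gamma (n + 1)))⁻¹) :
    ∫ x in E, f x ^ s ≤
      (volume E).toReal * (Gamma (n + s + 1) / (Gamma (s + 1) * Gamma (n + 1)))⁻¹ := by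
  have hs : 0 < s := hq.trans_le hqs
  have hconv : ∀ p : ℝ, 0 < p →
      ENNReal.ofReal (∫ x in E, f x ^ p) = ∫⁻ x in E, ENNReal.ofReal (f x ^ p) := fun p hp =>
    ofReal_integral_eq_lintegral_ofReal (hf.integrableOn_rpow hE hbdd hf0 hp.le)
      ((ae_restrict_iff' hE.measurableSet).2
        (Filter.Eventually.of_forall fun x hx => Real.rpow_nonneg (hf0 x hx) p))
  have hvol : ∀ r : ℝ, ENNReal.ofReal ((volume E).toReal * r) = volume E * ENNReal.ofReal r :=
    fun r => by
      rw [ENNReal.ofReal_mul ENNReal.toReal_nonneg, ENNReal.ofReal_toReal hbdd.measure_lt_top.ne]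
  have hΓ : 0 < Gamma (n + s + 1) / (Gamma (s + 1) * Gamma (n + 1)) := by
    have h1 := Gamma_pos_of_pos (show 0 < n + s + 1 by positivity)
    have h2 := Gamma_pos_of_pos (show 0 < s + 1 by positivity)
    have h3 := Gamma_pos_of_pos (show 0 < (n : ℝ) + 1 by positivity)
    positivity
  rw [← ENNReal.ofReal_le_ofReal_iff (by positivity), hconv s hs, hvol]
  refine hf.lintegral_rpow_le_of_lintegral_rpow_eq hE hbdd hf0 hq hqs ?_
  rw [← hconv q hq, h, hvol]

theorem stmt_18 (N : ℕ) (q s : ℝ) (hq : 0 < q) (hqs : q ≤ s)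
    (E : Set (EuclideanSpace ℝ (Fin N)))
    (hconv : Convex ℝ E) (hopen : IsOpen E) (hbdd : Bornology.IsBounded E)
    (hvol : 0 < (volume E).toReal)
    (f : EuclideanSpace ℝ (Fin N) → ℝ)
    (hf : ConcaveOn ℝ E f) (hf0 : ∀ x ∈ E, 0 ≤ f x) :
    ((volume E).toReal⁻¹ * ∫ x in E, f x ^ s) ^ (1 / s) ≤
      (Gamma (N + q + 1) / (Gamma (q + 1) * Gamma (N + 1))) ^ (1 / q) *
        (Gamma (N + s + 1) / (Gamma (s + 1) * Gamma (N + 1))) ^ (-(1 / s)) *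
        ((volume E).toReal⁻¹ * ∫ x in E, f x ^ q) ^ (1 / q) := by
  have hs : 0 < s := hq.trans_le hqs
  have hΓ : ∀ p : ℝ, 0 < p → 0 < Gamma (N + p + 1) / (Gamma (p + 1) * Gamma (N + 1)) := by
    intro p hp
    have h1 := Gamma_pos_of_pos (show 0 < N + p + 1 by positivity)
    have h2 := Gamma_pos_of_pos (show 0 < p + 1 by positivity)
    have h3 := Gamma_pos_of_pos (show 0 < (N : ℝ) + 1 by positivity)
    positivity
  have hB := hΓ q hq
  have hC := hΓ s hs
  have hJ0 : ∀ p : ℝ, 0 ≤ ∫ x in E, f x ^ p := fun p =>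
    setIntegral_nonneg hopen.measurableSet fun x hx => Real.rpow_nonneg (hf0 x hx) p
  rcases (hJ0 q).eq_or_lt with hI | hI
  · have hzero : ∫ x in E, f x ^ s = 0 := by
      have hae := (setIntegral_eq_zero_iff_of_nonneg_ae
        ((ae_restrict_iff' hopen.measurableSet).2
          (Filter.Eventually.of_forall fun x hx => Real.rpow_nonneg (hf0 x hx) q))
        (hf.integrableOn_rpow hopen hbdd hf0 hq.le)).1 hI.symm
      rw [integral_eq_zero_of_ae]
      filter_upwards [hae, ae_restrict_mem hopen.measurableSet] with x hx hxE
      have : f x = 0 := (Real.rpow_eq_zero (hf0 x hxE) hq.ne').1 hx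
      simp [this, hs.ne']
    have := hJ0 q
    rw [hzero, mul_zero, Real.zero_rpow (by positivity)]
    positivity
  · set B := Gamma (N + q + 1) / (Gamma (q + 1) * Gamma (N + 1))
    set C := Gamma (N + s + 1) / (Gamma (s + 1) * Gamma (N + 1))
    set V := (volume E).toReal
    set I := ∫ x in E, f x ^ q
    set c := (B * (V⁻¹ * I)) ^ (1 / q) with hc
    have hc0 : 0 < c := by positivity
    have hcq : c ^ q = B * (V⁻¹ * I) := by
      rw [hc, ← Real.rpow_mul (by positivity), one_div_mul_cancel hq.ne', Real.rpow_one]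
    have hscale : ∀ p : ℝ, ∫ x in E, (c⁻¹ • f) x ^ p = (c ^ p)⁻¹ * ∫ x in E, f x ^ p := by
      intro p
      rw [← integral_const_mul]
      refine setIntegral_congr_fun hopen.measurableSet fun x hx => ?_
      simp only [Pi.smul_apply, smul_eq_mul]
      rw [Real.mul_rpow (by positivity) (hf0 x hx), Real.inv_rpow hc0.le]
    have key := (hf.smul (inv_nonneg.2 hc0.le)).integral_rpow_le_of_integral_rpow_eq hopen hbdd
      (fun x hx => mul_nonneg (inv_nonneg.2 hc0.le) (hf0 x hx)) hq hqs
      (by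
        refine (hscale q).trans ?_
        rw [hcq]
        change (B * (V⁻¹ * I))⁻¹ * I = V * B⁻¹
        field_simp)
    replace key : (c ^ s)⁻¹ * ∫ x in E, f x ^ s ≤ V * C⁻¹ := (hscale s).symm.trans_le key
    rw [inv_mul_le_iff₀ (by positivity)] at key
    calc (V⁻¹ * ∫ x in E, f x ^ s) ^ (1 / s) ≤ (c ^ s * C⁻¹) ^ (1 / s) := by
          refine Real.rpow_le_rpow (mul_nonneg (by positivity) (hJ0 s)) ?_ (by positivity)
          rw [inv_mul_le_iff₀ hvol]
          linarith
      _ = c * C ^ (-(1 / s)) := by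
          rw [Real.mul_rpow (by positivity) (by positivity), ← Real.rpow_mul hc0.le,
            mul_one_div_cancel hs.ne', Real.rpow_one, Real.inv_rpow hC.le, Real.rpow_neg hC.le]
      _ = B ^ (1 / q) * C ^ (-(1 / s)) * (V⁻¹ * I) ^ (1 / q) := by
          rw [hc, Real.mul_rpow hB.le (by positivity)]
          ring
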